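/- Fix r₀ > 0, 𝓔 > 0, a nonzero integer m, and ε with 0 < ε < 1. On the open set Ω₀ = {(x,y,z) ∈ ℝ³ : r > 0}, where r = √(x²+y²) and φ is the azimuthal angle, define Ψ = (1/2)(r−r₀)² + (1/2) 𝓔 (z − h)² with h = ε z sin(mφ), i.e. Ψ = (1/2)(r−r₀)² + (1/2) 𝓔 z² (1 − ε sin(mφ))². If constant vectors a, b ∈ ℝ³ satisfy (a + b×x)·∇Ψ(x) = 0 for every x ∈ Ω₀, then a = b = 0. Consequently the toroidal level sets of Ψ are not invariant under any nontrivial continuous Euclidean isometry. -/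

import Mathlib

/-- Partial derivative of a scalar field on `ℝ³` in the `i`-th coordinate direction. -/
noncomputable def pd (i : Fin 3) (f : (Fin 3 → ℝ) → ℝ) (x : Fin 3 → ℝ) : ℝ :=
  fderiv ℝ f x (Pi.single i 1)

/-- Gradient of a scalar field on `ℝ³`. -/
noncomputable def grad (f : (Fin 3 → ℝ) → ℝ) (x : Fin 3 → ℝ) : Fin 3 → ℝ :=
  ![pd 0 f x, pd 1 f x, pd 2 f x]

/-- Divergence of a vector field on `ℝ³`. -/
noncomputable def div3 (w : (Fin 3 → ℝ) → (Fin 3 → ℝ)) (x : Fin 3 → ℝ) : ℝ :=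
  pd 0 (fun y => w y 0) x + pd 1 (fun y => w y 1) x + pd 2 (fun y => w y 2) x

/-- Curl of a vector field on `ℝ³`. -/
noncomputable def curl (w : (Fin 3 → ℝ) → (Fin 3 → ℝ)) (x : Fin 3 → ℝ) : Fin 3 → ℝ :=
  ![pd 1 (fun y => w y 2) x - pd 2 (fun y => w y 1) x,
    pd 2 (fun y => w y 0) x - pd 0 (fun y => w y 2) x,
    pd 0 (fun y => w y 1) x - pd 1 (fun y => w y 0) x]

/-- Cross product on `ℝ³`. -/
def cross3 (u v : Fin 3 → ℝ) : Fin 3 → ℝ :=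
  ![u 1 * v 2 - u 2 * v 1, u 2 * v 0 - u 0 * v 2, u 0 * v 1 - u 1 * v 0]

/-- Dot product on `ℝ³`. -/
def dot3 (u v : Fin 3 → ℝ) : ℝ := u 0 * v 0 + u 1 * v 1 + u 2 * v 2

open scoped Real

/-- The cylindrical radius `r = √(x² + y²)`. -/
noncomputable def cylR (p : Fin 3 → ℝ) : ℝ := Real.sqrt (p 0 ^ 2 + p 1 ^ 2)

/-- The azimuthal angle `φ` of a point of `ℝ³`. -/
noncomputable def cylφ (p : Fin 3 → ℝ) : ℝ := Complex.arg ((p 0 : ℂ) + (p 1 : ℂ) * Complex.I)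

lemma cylφ_eq_arctan {p : Fin 3 → ℝ} (hp : 0 < p 0) : cylφ p = Real.arctan (p 1 / p 0) := by
  have hre : ((p 0 : ℂ) + (p 1 : ℂ) * Complex.I).re = p 0 := by simp
  have him : ((p 0 : ℂ) + (p 1 : ℂ) * Complex.I).im = p 1 := by simp
  have habs : |cylφ p| < π / 2 :=
    Complex.abs_arg_lt_pi_div_two_iff.2 (Or.inl (by rw [hre]; exact hp))
  have htan : Real.tan (cylφ p) = p 1 / p 0 := by
    rw [cylφ, Complex.tan_arg, hre, him]
  rw [← htan, Real.arctan_tan (abs_lt.1 habs).1 (abs_lt.1 habs).2]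

lemma cylR_pos {p : Fin 3 → ℝ} (hp : 0 < p 0) : 0 < cylR p :=
  Real.sqrt_pos.2 (by positivity)

lemma cylR_sq (p : Fin 3 → ℝ) : cylR p ^ 2 = p 0 ^ 2 + p 1 ^ 2 :=
  Real.sq_sqrt (by positivity)

lemma hasFDerivAt_coord (i : Fin 3) (p : Fin 3 → ℝ) :
    HasFDerivAt (fun q : Fin 3 → ℝ => q i)
      (ContinuousLinearMap.proj i : (Fin 3 → ℝ) →L[ℝ] ℝ) p :=
  (ContinuousLinearMap.proj i : (Fin 3 → ℝ) →L[ℝ] ℝ).hasFDerivAt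

lemma hasFDerivAt_cylR {p : Fin 3 → ℝ} (hp : 0 < p 0) :
    HasFDerivAt cylR
      ((p 0 / cylR p) • (ContinuousLinearMap.proj 0 : (Fin 3 → ℝ) →L[ℝ] ℝ) +
        (p 1 / cylR p) • (ContinuousLinearMap.proj 1 : (Fin 3 → ℝ) →L[ℝ] ℝ)) p := by
  have hR := cylR_pos hp
  have hne : p 0 ^ 2 + p 1 ^ 2 ≠ 0 := by positivity
  have hd := (((hasFDerivAt_coord 0 p).pow 2).add ((hasFDerivAt_coord 1 p).pow 2)).sqrt hne
  refine hd.congr_fderiv ?_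
  ext v
  change (1 / (2 * cylR p)) * _ = _
  simp
  field_simp

lemma hasFDerivAt_cylφ {p : Fin 3 → ℝ} (hp : 0 < p 0) :
    HasFDerivAt cylφ
      ((p 0 / cylR p ^ 2) • (ContinuousLinearMap.proj 1 : (Fin 3 → ℝ) →L[ℝ] ℝ) -
        (p 1 / cylR p ^ 2) • (ContinuousLinearMap.proj 0 : (Fin 3 → ℝ) →L[ℝ] ℝ)) p := by
  have hinv := (hasDerivAt_inv hp.ne').comp_hasFDerivAt p (hasFDerivAt_coord 0 p)
  have hd := ((hasFDerivAt_coord 1 p).mul hinv).arctan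
  have hev : cylφ =ᶠ[nhds p] fun q => Real.arctan (q 1 * (q 0)⁻¹) := by
    filter_upwards [(continuous_apply 0).continuousAt.eventually (lt_mem_nhds hp)] with q hq
    simpa [div_eq_mul_inv] using cylφ_eq_arctan hq
  refine (hd.congr_of_eventuallyEq hev).congr_fderiv ?_
  ext v
  have hne : p 0 ^ 2 + p 1 ^ 2 ≠ 0 := by positivity
  rw [cylR_sq]
  simp
  field_simp
  ring

/-- The flux function of the displaced elliptic torus. -/
noncomputable def torusFlux (r₀ E ε : ℝ) (m : ℤ) (p : Fin 3 → ℝ) : ℝ :=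
  (1/2) * (cylR p - r₀) ^ 2 +
    (1/2) * E * p 2 ^ 2 * (1 - ε * Real.sin ((m : ℝ) * cylφ p)) ^ 2

lemma grad_torusFlux (r₀ E ε : ℝ) (m : ℤ) {p : Fin 3 → ℝ} (hp : 0 < p 0) :
    grad (torusFlux r₀ E ε m) p =
      ![(cylR p - r₀) * (p 0 / cylR p) + E * p 2 ^ 2 * (1 - ε * Real.sin (m * cylφ p)) *
          (ε * m * Real.cos (m * cylφ p)) * (p 1 / cylR p ^ 2),
        (cylR p - r₀) * (p 1 / cylR p) - E * p 2 ^ 2 * (1 - ε * Real.sin (m * cylφ p)) *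
          (ε * m * Real.cos (m * cylφ p)) * (p 0 / cylR p ^ 2),
        E * p 2 * (1 - ε * Real.sin (m * cylφ p)) ^ 2] := by
  have hd := ((((hasFDerivAt_cylR hp).sub_const r₀).pow 2).const_mul (1/2)).add
    ((((hasFDerivAt_coord 2 p).pow 2).const_mul (1/2 * E)).mul
      ((((((hasFDerivAt_cylφ hp).const_mul (m : ℝ)).sin).const_mul ε).const_sub 1).pow 2))
  have hf : fderiv ℝ (torusFlux r₀ E ε m) p = _ := hd.fderiv
  ext i
  fin_cases i <;> simp [grad, pd, hf] <;> ring

/-- The Lie derivative of the flux function in cylindrical coordinates, away from the branch cut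
of the azimuthal angle. -/
lemma dot3_grad_torusFlux (r₀ E ε : ℝ) (m : ℤ) (a b : Fin 3 → ℝ) {r θ : ℝ} (z : ℝ) (hr : 0 < r)
    (hθ : θ ∈ Set.Ioo (-(π / 2)) (π / 2)) :
    0 < cylR ![r * Real.cos θ, r * Real.sin θ, z] ∧
    dot3 (a + cross3 b ![r * Real.cos θ, r * Real.sin θ, z])
        (grad (torusFlux r₀ E ε m) ![r * Real.cos θ, r * Real.sin θ, z]) =
      (r - r₀) * (a 0 * Real.cos θ + a 1 * Real.sin θ +
          z * (b 1 * Real.cos θ - b 0 * Real.sin θ)) -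
        E * z ^ 2 * (1 - ε * Real.sin (m * θ)) * (ε * m * Real.cos (m * θ)) / r *
          (a 1 * Real.cos θ - a 0 * Real.sin θ + b 2 * r -
            z * (b 1 * Real.sin θ + b 0 * Real.cos θ)) +
        E * z * (1 - ε * Real.sin (m * θ)) ^ 2 *
          (a 2 + r * (b 0 * Real.sin θ - b 1 * Real.cos θ)) := by
  have hcos : 0 < Real.cos θ := Real.cos_pos_of_mem_Ioo hθ
  have hp : 0 < (![r * Real.cos θ, r * Real.sin θ, z] : Fin 3 → ℝ) 0 := mul_pos hr hcos
  have hR : cylR ![r * Real.cos θ, r * Real.sin θ, z] = r := by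
    rw [cylR]
    simp only [Matrix.cons_val_zero, Matrix.cons_val_one]
    rw [mul_pow, mul_pow, ← mul_add, Real.cos_sq_add_sin_sq, mul_one, Real.sqrt_sq hr.le]
  have hφ : cylφ ![r * Real.cos θ, r * Real.sin θ, z] = θ := by
    rw [cylφ_eq_arctan hp]
    simp only [Matrix.cons_val_zero, Matrix.cons_val_one]
    rw [mul_div_mul_left _ _ hr.ne', ← Real.tan_eq_sin_div_cos, Real.arctan_tan hθ.1 hθ.2]
  refine ⟨hR.symm ▸ hr, ?_⟩
  rw [grad_torusFlux r₀ E ε m hp, hR, hφ]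
  simp only [dot3, cross3, Pi.add_apply, Matrix.cons_val_zero, Matrix.cons_val_one,
    Matrix.cons_val]
  have hs := Real.cos_sq_add_sin_sq θ
  generalize Real.cos (m * θ) = C
  generalize Real.sin (m * θ) = S
  generalize Real.cos θ = c at *
  generalize Real.sin θ = s at *
  field_simp
  linear_combination (-(b 2 * r * E * z ^ 2 * (1 - ε * S) * ε * m * C)) * hs

/-- the flux function
`Ψ = (1/2)(r−r₀)² + (1/2)𝓔 z²(1 − ε sin(mφ))²` (i.e. `(1/2)(r−r₀)² + (1/2)𝓔(z−h)²` with
`h = ε z sin(mφ)`) admits no nontrivial continuous Euclidean isometry: if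
`(a + b×x)·∇Ψ = 0` on `{r > 0}` then `a = b = 0`. -/
theorem displaced_elliptic_torus_no_isometry
    (r₀ E ε : ℝ) (hr₀ : 0 < r₀) (hE : 0 < E) (hε₀ : 0 < ε) (hε₁ : ε < 1)
    (m : ℤ) (hm : m ≠ 0)
    (Ψ : (Fin 3 → ℝ) → ℝ)
    (hΨ : ∀ p : Fin 3 → ℝ, Ψ p =
      (1/2) * (cylR p - r₀) ^ 2 +
      (1/2) * E * p 2 ^ 2 * (1 - ε * Real.sin ((m : ℝ) * cylφ p)) ^ 2)
    (a b : Fin 3 → ℝ)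
    (h : ∀ p : Fin 3 → ℝ, 0 < cylR p → dot3 (a + cross3 b p) (grad Ψ p) = 0) :
    a = 0 ∧ b = 0 := by
  obtain rfl : Ψ = torusFlux r₀ E ε m := funext hΨ
  have lie : ∀ r θ z : ℝ, 0 < r → θ ∈ Set.Ioo (-(π / 2)) (π / 2) → _ = (0 : ℝ) :=
    fun r θ z hr hθ =>
      have key := dot3_grad_torusFlux r₀ E ε m a b z hr hθ
      key.2.symm.trans (h _ key.1)
  have hm' : (m : ℝ) ≠ 0 := Int.cast_ne_zero.2 hm
  have h0 : (0 : ℝ) ∈ Set.Ioo (-(π / 2)) (π / 2) := by constructor <;> linarith [Real.pi_pos]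
  have hr2 : 0 < 2 * r₀ := by positivity
  have hE' := hE.ne'
  have hε' := hε₀.ne'
  have hr' := hr₀.ne'
  have hk : E * (ε * m) / r₀ ≠ 0 := by positivity
  have e0 := lie (2 * r₀) 0 0 hr2 h0
  have e1 := lie r₀ 0 1 hr₀ h0
  have e2 := lie r₀ 0 (-1) hr₀ h0
  have e3 := lie r₀ 0 2 hr₀ h0
  have e4 := lie (2 * r₀) 0 1 hr2 h0
  have e5 := lie (2 * r₀) 0 (-1) hr2 h0
  simp only [mul_zero, Real.sin_zero, Real.cos_zero] at e0 e1 e2 e3 e4 e5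
  have ha0 : a 0 = 0 := (mul_eq_zero.1
    (show r₀ * a 0 = 0 by linear_combination e0)).resolve_left hr'
  have hab : a 1 + b 2 * r₀ = 0 := (mul_eq_zero.1
    (show E * (ε * m) / r₀ * (a 1 + b 2 * r₀) = 0 by
      linear_combination -(e1 + e2) / 2)).resolve_left hk
  have hb0 : b 0 = 0 := (mul_eq_zero.1
    (show E * (ε * m) / r₀ * b 0 = 0 by
      linear_combination (e3 - 2 * e1) / 6 + E * (ε * m) / r₀ * hab / 3)).resolve_left hk
  have hab' : a 1 + b 2 * (2 * r₀) = 0 := (mul_eq_zero.1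
    (show E * (ε * m) / r₀ * (a 1 + b 2 * (2 * r₀)) = 0 by
      linear_combination -(e4 + e5) + 2 * r₀ * ha0)).resolve_left hk
  have hb2 : b 2 = 0 := (mul_eq_zero.1
    (show r₀ * b 2 = 0 by linear_combination hab' - hab)).resolve_left hr'
  have ha1 : a 1 = 0 := by linear_combination hab - r₀ * hb2
  have ha2 : a 2 = r₀ * b 1 := by
    have : E * (a 2 - r₀ * b 1) = 0 := by
      linear_combination e1 + E * (ε * m) / r₀ * (hab - hb0)
    linarith [(mul_eq_zero.1 this).resolve_left hE']
  have hm1 : (1 : ℝ) ≤ |(m : ℝ)| := by exact_mod_cast Int.one_le_abs hm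
  have hmul : (m : ℝ) * (π / 3 / m) = π / 3 := by field_simp
  have habs : |π / 3 / (m : ℝ)| < π / 2 := by
    rw [abs_div, abs_of_pos (by positivity : 0 < π / 3)]
    exact (div_le_self (by positivity) hm1).trans_lt (by linarith [Real.pi_pos])
  have hδ : π / 3 / (m : ℝ) ∈ Set.Ioo (-(π / 2)) (π / 2) := abs_lt.1 habs
  have hsin : Real.sin (π / 3 / m) ≠ 0 := by
    rw [Ne, Real.sin_eq_zero_iff_of_lt_of_lt (by linarith [hδ.1, Real.pi_pos])
      (by linarith [hδ.2, Real.pi_pos])]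
    have := Real.pi_ne_zero
    positivity
  have f1 := lie r₀ (π / 3 / m) 1 hr₀ hδ
  have f2 := lie r₀ (π / 3 / m) 2 hr₀ hδ
  rw [hmul, Real.cos_pi_div_three, ha0, ha1, hb0, hb2] at f1 f2
  have hF : 0 < 1 - ε * Real.sin (π / 3) := by nlinarith [Real.sin_le_one (π / 3)]
  have hb1 : b 1 = 0 := (mul_eq_zero.1
    (show (E * (ε * m) / r₀) * (1 - ε * Real.sin (π / 3)) * Real.sin (π / 3 / m) * b 1 = 0 by
      linear_combination (f2 - 2 * f1) / 3)).resolve_left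
        (mul_ne_zero (mul_ne_zero hk hF.ne') hsin)
  rw [hb1, mul_zero] at ha2
  constructor <;> ext i <;> fin_cases i <;> assumption
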